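/- For each n ≥ 1, the set E_n = ⋃_{x₀ ∈ B_n} J(x₀), the union over all balanced dyadic rationals of generation n of the intervals J(x₀) = [T(x₀), T(x₀) + (2/3)·4^{-m(x₀)}], is dense in [0, 2/3] (its closure contains [0, 2/3]). -/

import Mathlib

open Set MeasureTheory ENNReal

/-- `phi x` is the distance from `x` to the nearest integer. -/
noncomputable def phi (x : ℝ) : ℝ := |x - (round x : ℤ)|

/-- The Takagi function. -/
noncomputable def T (x : ℝ) : ℝ := ∑' n : ℕ, phi (2 ^ n * x) / 2 ^ n

/-- The `n`-th binary digit of `x` (terminating expansion for dyadic rationals). -/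
noncomputable def eps (n : ℕ) (x : ℝ) : ℤ := ⌊2 ^ n * x⌋ - 2 * ⌊2 ^ (n - 1) * x⌋

/-- `D k x = ∑_{j=1}^k (-1)^{ε_j(x)}`, the excess of 0 digits over 1 digits. -/
noncomputable def D (k : ℕ) (x : ℝ) : ℤ := ∑ j ∈ Finset.Icc 1 k, (1 - 2 * eps j x)

/-- The level set of the Takagi function at level `y`. -/
def L (y : ℝ) : Set ℝ := {x | x ∈ Set.Icc (0:ℝ) 1 ∧ T x = y}

/-- `x` is a balanced dyadic rational of order `m`. -/
def BalancedOfOrder (x : ℝ) (m : ℕ) : Prop :=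
  x ∈ Set.Ico (0:ℝ) 1 ∧ (∃ k : ℤ, x = (k : ℝ) / 2 ^ (2 * m)) ∧ D (2 * m) x = 0

/-- The generation of a balanced dyadic rational of order `m`:
the number of indices `1 ≤ j ≤ 2m` with `D j x = 0`. -/
noncomputable def generation (x : ℝ) (m : ℕ) : ℕ :=
  ((Finset.Icc 1 (2 * m)).filter (fun j => D j x = 0)).card

/-- A balanced dyadic rational of order `m` is leading if `D j x ≥ 0` for all `1 ≤ j ≤ 2m`. -/
def Leading (x : ℝ) (m : ℕ) : Prop := ∀ j ∈ Finset.Icc 1 (2 * m), 0 ≤ D j x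

/-- The equivalence relation whose classes are the local level sets. -/
def locSetoid : Setoid ℝ where
  r x x' := ∀ n : ℕ, 1 ≤ n → |D n x| = |D n x'|
  iseqv := ⟨fun _ _ _ => rfl, fun h n hn => (h n hn).symm,
    fun h g n hn => (h n hn).trans (g n hn)⟩

/-- The set of local level sets contained in `L y`: the image of `L y ∩ [0,1)`
under the quotient map of `locSetoid`. -/
def locClasses (y : ℝ) : Set (Quotient locSetoid) :=
  Quotient.mk locSetoid '' (L y ∩ Set.Ico (0:ℝ) 1)

/-! ### Distance to the nearest integer -/

lemma phi_nonneg (x : ℝ) : 0 ≤ phi x := abs_nonneg _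

lemma phi_le_half (x : ℝ) : phi x ≤ 1 / 2 := abs_sub_round x

lemma phi_le_abs_sub (x : ℝ) (k : ℤ) : phi x ≤ |x - k| := round_le x k

lemma phi_eq_of_abs_sub_le {x : ℝ} {k : ℤ} (h : |x - k| ≤ 1 / 2) : phi x = |x - k| := by
  apply le_antisymm (phi_le_abs_sub x k)
  unfold phi
  rcases eq_or_ne (round x) k with hk | hk
  · rw [hk]
  · have h1 : (1 : ℝ) ≤ |(round x : ℝ) - k| := by
      exact_mod_cast Int.one_le_abs (sub_ne_zero.2 hk)
    have h2 : |(round x : ℝ) - k| ≤ |x - round x| + |x - k| := by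
      rw [abs_sub_comm x (round x)]
      exact abs_sub_le _ _ _
    linarith

lemma abs_phi_sub_le (x y : ℝ) : |phi x - phi y| ≤ |x - y| := by
  have key (a b : ℝ) : phi a ≤ |a - b| + phi b :=
    (phi_le_abs_sub a (round b)).trans (abs_sub_le _ _ _)
  have h1 := key x y
  have h2 := key y x
  rw [abs_sub_comm y x] at h2
  exact abs_sub_le_iff.2 ⟨by linarith, by linarith⟩

lemma continuous_phi : Continuous phi := by
  refine (LipschitzWith.of_dist_le_mul (K := 1) fun x y => ?_).continuous
  simpa [Real.dist_eq] using abs_phi_sub_le x y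

lemma phi_add_int (x : ℝ) (k : ℤ) : phi (x + k) = phi x := by
  unfold phi
  rw [round_add_intCast]
  push_cast
  congr 1
  ring

lemma phi_intCast (k : ℤ) : phi k = 0 := by
  simp [phi]

lemma phi_two_mul_le (x : ℝ) : phi (2 * x) ≤ 1 - 2 * phi x := by
  have h := phi_le_half x
  unfold phi at h ⊢
  rcases abs_cases (x - (round x : ℝ)) with ⟨h1, h2⟩ | ⟨h1, h2⟩
  · rw [h1] at h ⊢
    refine (phi_le_abs_sub (2 * x) (2 * round x + 1)).trans ?_
    push_cast
    rw [abs_le]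
    constructor <;> linarith
  · rw [h1] at h ⊢
    refine (phi_le_abs_sub (2 * x) (2 * round x - 1)).trans ?_
    push_cast
    rw [abs_le]
    constructor <;> linarith

lemma phi_two_mul_of_phi_eq_third {x : ℝ} (h : phi x = 1 / 3) : phi (2 * x) = 1 / 3 := by
  unfold phi at h
  rcases abs_cases (x - (round x : ℝ)) with ⟨h1, h2⟩ | ⟨h1, h2⟩
  · have : 2 * x - ((2 * round x + 1 : ℤ) : ℝ) = -(1 / 3) := by push_cast; linarith
    rw [phi_eq_of_abs_sub_le (k := 2 * round x + 1)] <;> rw [this] <;> norm_num [abs_of_pos]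
  · have : 2 * x - ((2 * round x - 1 : ℤ) : ℝ) = 1 / 3 := by push_cast; linarith
    rw [phi_eq_of_abs_sub_le (k := 2 * round x - 1)] <;> rw [this] <;> norm_num [abs_of_pos]

/-! ### Binary floors -/

lemma floor_two_mul_cases (t : ℝ) : ⌊2 * t⌋ = 2 * ⌊t⌋ ∨ ⌊2 * t⌋ = 2 * ⌊t⌋ + 1 := by
  have h1 := Int.floor_le t
  have h2 := Int.lt_floor_add_one t
  have h3 : 2 * ⌊t⌋ ≤ ⌊2 * t⌋ := Int.le_floor.2 (by push_cast; linarith)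
  have h4 : ⌊2 * t⌋ < 2 * ⌊t⌋ + 2 := Int.floor_lt.2 (by push_cast; linarith)
  omega

lemma phi_eq_floor (t : ℝ) :
    phi t = ((⌊2 * t⌋ - 2 * ⌊t⌋ : ℤ) : ℝ) +
      (1 - 2 * ((⌊2 * t⌋ - 2 * ⌊t⌋ : ℤ) : ℝ)) * (t - ⌊t⌋) := by
  have h1 := Int.floor_le t
  have h2 := Int.lt_floor_add_one t
  have h3 := Int.floor_le (2 * t)
  have h4 := Int.lt_floor_add_one (2 * t)
  rcases floor_two_mul_cases t with h | h
  · rw [h] at h3 h4 ⊢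
    push_cast at h3 h4 ⊢
    have h5 : |t - (⌊t⌋ : ℝ)| = t - ⌊t⌋ := abs_of_nonneg (by linarith)
    rw [phi_eq_of_abs_sub_le (k := ⌊t⌋) (by rw [h5]; linarith), h5]
    ring
  · rw [h] at h3 h4 ⊢
    push_cast at h3 h4 ⊢
    have h5 : |t - ((⌊t⌋ + 1 : ℤ) : ℝ)| = ⌊t⌋ + 1 - t := by
      push_cast
      rw [abs_of_nonpos (by linarith)]
      ring
    rw [phi_eq_of_abs_sub_le (k := ⌊t⌋ + 1) (by rw [h5]; linarith), h5]
    ring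

lemma floor_eq_of_floor_two_mul_eq {s t : ℝ} (h : ⌊2 * s⌋ = ⌊2 * t⌋) : ⌊s⌋ = ⌊t⌋ := by
  rcases floor_two_mul_cases s with hs | hs <;> rcases floor_two_mul_cases t with ht | ht <;> omega

lemma floor_two_pow_mul_eq_of_le {x y : ℝ} {j N : ℕ} (hj : j ≤ N)
    (h : ⌊2 ^ N * x⌋ = ⌊2 ^ N * y⌋) : ⌊2 ^ j * x⌋ = ⌊2 ^ j * y⌋ := by
  induction N, hj using Nat.le_induction with
  | base => exact h
  | succ N _ ih =>
    refine ih (floor_eq_of_floor_two_mul_eq ?_)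
    rw [← mul_assoc, ← mul_assoc, ← pow_succ']
    exact h

lemma eps_succ (j : ℕ) (x : ℝ) :
    eps (j + 1) x = ⌊2 * (2 ^ j * x)⌋ - 2 * ⌊2 ^ j * x⌋ := by
  simp only [eps, Nat.add_sub_cancel, pow_succ', mul_assoc]

lemma D_succ (k : ℕ) (x : ℝ) : D (k + 1) x = D k x + (1 - 2 * eps (k + 1) x) := by
  unfold D
  rw [Finset.sum_Icc_succ_top (by omega)]

lemma D_zero (x : ℝ) : D 0 x = 0 := by simp [D]

lemma D_eq_of_floor_eq {x y : ℝ} {j N : ℕ} (hj : j ≤ N)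
    (h : ⌊2 ^ N * x⌋ = ⌊2 ^ N * y⌋) : D j x = D j y := by
  unfold D
  refine Finset.sum_congr rfl fun i hi => ?_
  rw [Finset.mem_Icc] at hi
  unfold eps
  rw [floor_two_pow_mul_eq_of_le (by omega : i ≤ N) h,
    floor_two_pow_mul_eq_of_le (by omega : i - 1 ≤ N) h]

lemma even_D_sub (k : ℕ) (x : ℝ) : Even (D k x - k) := by
  induction k with
  | zero => simp [D_zero]
  | succ k ih =>
    rw [D_succ]
    obtain ⟨r, hr⟩ := ih
    exact ⟨r - eps (k + 1) x, by push_cast; omega⟩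

/-! ### The Takagi function -/

lemma phi_div_two_pow_le (x : ℝ) (n : ℕ) : phi (2 ^ n * x) / 2 ^ n ≤ 1 / 2 / 2 ^ n := by
  have := phi_le_half (2 ^ n * x)
  gcongr

lemma phi_div_two_pow_nonneg (x : ℝ) (n : ℕ) : 0 ≤ phi (2 ^ n * x) / 2 ^ n :=
  div_nonneg (phi_nonneg _) (by positivity)

lemma hasSum_div_two_pow (c : ℝ) : HasSum (fun n : ℕ => c / 2 / 2 ^ n) c :=
  hasSum_geometric_two' c

lemma summable_T (x : ℝ) : Summable fun n : ℕ => phi (2 ^ n * x) / 2 ^ n :=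
  Summable.of_nonneg_of_le (phi_div_two_pow_nonneg x) (phi_div_two_pow_le x)
    (hasSum_div_two_pow 1).summable

lemma continuous_T : Continuous T := by
  refine continuous_tsum (fun n => ?_) (hasSum_div_two_pow 1).summable fun n x => ?_
  · exact (continuous_phi.comp (continuous_const.mul continuous_id)).div_const _
  · rw [Real.norm_of_nonneg (phi_div_two_pow_nonneg x n)]
    exact phi_div_two_pow_le x n

lemma T_nonneg (x : ℝ) : 0 ≤ T x := tsum_nonneg (phi_div_two_pow_nonneg x)

lemma T_le_one (x : ℝ) : T x ≤ 1 :=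
  ((summable_T x).tsum_le_tsum (phi_div_two_pow_le x) (hasSum_div_two_pow 1).summable).trans_eq
    (hasSum_div_two_pow 1).tsum_eq

lemma T_eq_sum_add (M : ℕ) (x : ℝ) :
    T x = ∑ j ∈ Finset.range M, phi (2 ^ j * x) / 2 ^ j + T (2 ^ M * x) / 2 ^ M := by
  unfold T
  rw [← (summable_T x).sum_add_tsum_nat_add M, ← tsum_div_const]
  congr 2
  ext i
  rw [pow_add, mul_assoc, div_div]

lemma T_add_int (x : ℝ) (k : ℤ) : T (x + k) = T x := by
  unfold T
  congr 1
  ext n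
  have : (2 : ℝ) ^ n * (x + k) = 2 ^ n * x + ((2 ^ n * k : ℤ) : ℝ) := by push_cast; ring
  rw [this, phi_add_int]

lemma T_zero : T 0 = 0 := by
  have := phi_intCast 0
  simp_all [T]

lemma T_intCast (k : ℤ) : T k = 0 := by
  rw [← zero_add (k : ℝ), T_add_int, T_zero]

lemma T_le_two_thirds (x : ℝ) : T x ≤ 2 / 3 := by
  have key (k : ℕ) : ∀ x, T x ≤ 2 / 3 + 1 / 3 * (1 / 4) ^ k := by
    induction k with
    | zero => intro x; have := T_le_one x; norm_num; exact this
    | succ k ih =>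
      intro x
      have h1 := T_eq_sum_add 2 x
      have h2 := phi_two_mul_le x
      have h3 := ih (2 ^ 2 * x)
      rw [Finset.sum_range_succ, Finset.sum_range_one] at h1
      norm_num at h1 h3
      rw [pow_succ, h1]
      norm_num
      linarith
  have hlim : Filter.Tendsto (fun k : ℕ => (2 / 3 + 1 / 3 * (1 / 4) ^ k : ℝ)) Filter.atTop
      (nhds (2 / 3 + 1 / 3 * 0)) :=
    ((_root_.tendsto_pow_atTop_nhds_zero_of_lt_one (by norm_num) (by norm_num)).const_mul
      _).const_add _
  simpa using ge_of_tendsto' hlim fun k => key k x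

lemma T_one_third : T (1 / 3) = 2 / 3 := by
  have h (n : ℕ) : phi (2 ^ n * (1 / 3)) = 1 / 3 := by
    induction n with
    | zero =>
      have h0 : |(1 / 3 : ℝ) - ((0 : ℤ) : ℝ)| = 1 / 3 := by norm_num [abs_of_pos]
      rw [pow_zero, one_mul, phi_eq_of_abs_sub_le (k := 0) (by rw [h0]; norm_num), h0]
    | succ n ih =>
      rw [pow_succ', mul_assoc]
      exact phi_two_mul_of_phi_eq_third ih
  unfold T
  simp_rw [h]
  convert (hasSum_div_two_pow (2 / 3)).tsum_eq using 4
  norm_num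

lemma exists_T_eq {y : ℝ} (hy : y ∈ Icc (0 : ℝ) (2 / 3)) : ∃ x ∈ Icc (0 : ℝ) (1 / 3), T x = y := by
  have := intermediate_value_Icc (by norm_num : (0 : ℝ) ≤ 1 / 3) continuous_T.continuousOn
  rw [T_zero, T_one_third] at this
  exact this hy

/-- Truncating `x` after `M` digits, where `D M x = 0`, the graph of `T` near `x` is a scaled copy
of the whole graph. -/
lemma T_eq_of_D_eq_zero {x : ℝ} {M : ℕ} (hD : D M x = 0) :
    T x = T (⌊2 ^ M * x⌋ / 2 ^ M) + T (2 ^ M * x) / 2 ^ M := by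
  have hfl : ⌊2 ^ M * (⌊2 ^ M * x⌋ / 2 ^ M : ℝ)⌋ = ⌊2 ^ M * x⌋ := by
    rw [mul_div_cancel₀ _ (by positivity : (2 : ℝ) ^ M ≠ 0), Int.floor_intCast]
  set x₀ : ℝ := ⌊2 ^ M * x⌋ / 2 ^ M with hx₀
  have hsum : ∑ j ∈ Finset.range M, phi (2 ^ j * x) / 2 ^ j
      - ∑ j ∈ Finset.range M, phi (2 ^ j * x₀) / 2 ^ j = (D M x : ℝ) * (x - x₀) := by
    rw [← Finset.sum_sub_distrib]
    have hDM : D M x = ∑ j ∈ Finset.range M, (1 - 2 * eps (j + 1) x) := by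
      unfold D
      rw [Finset.range_eq_Ico, Finset.sum_Ico_add' (fun j => 1 - 2 * eps j x) 0 M 1]
      rfl
    rw [hDM, Int.cast_sum, Finset.sum_mul]
    refine Finset.sum_congr rfl fun j hj => ?_
    rw [Finset.mem_range] at hj
    have h1 := floor_two_pow_mul_eq_of_le (by omega : j ≤ M) hfl
    have h2 := floor_two_pow_mul_eq_of_le (by omega : j + 1 ≤ M) hfl
    rw [pow_succ', mul_assoc, mul_assoc] at h2
    rw [eps_succ, phi_eq_floor (2 ^ j * x), phi_eq_floor (2 ^ j * x₀), h1, h2]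
    field_simp
    push_cast
    ring
  have hx₀_int : (2 : ℝ) ^ M * x₀ = (⌊2 ^ M * x⌋ : ℤ) := by
    rw [hx₀, mul_div_cancel₀ _ (by positivity : (2 : ℝ) ^ M ≠ 0)]
  rw [T_eq_sum_add M x, T_eq_sum_add M x₀, hx₀_int, T_intCast, zero_div]
  rw [hD] at hsum
  rw [Int.cast_zero, zero_mul] at hsum
  linarith

/-! ### Prescribing digits -/

lemma exists_D_succ_eq (x : ℝ) (N : ℕ) {b : ℤ} (hb : b = 0 ∨ b = 1) :
    ∃ x', ⌊2 ^ N * x'⌋ = ⌊2 ^ N * x⌋ ∧ D (N + 1) x' = D N x + (1 - 2 * b) := by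
  have hpos : (2 : ℝ) ^ N ≠ 0 := by positivity
  set a := ⌊2 ^ N * x⌋ with ha
  have h1 : (2 : ℝ) ^ N * ((a + b / 2) / 2 ^ N) = a + b / 2 := mul_div_cancel₀ _ hpos
  have hfl : ⌊(2 : ℝ) ^ N * ((a + b / 2) / 2 ^ N)⌋ = a := by
    rw [h1, Int.floor_eq_iff]
    rcases hb with rfl | rfl <;> norm_num
  refine ⟨(a + b / 2) / 2 ^ N, hfl, ?_⟩
  rw [D_succ, D_eq_of_floor_eq le_rfl hfl, eps_succ, hfl, h1]
  have : (2 : ℝ) * (a + b / 2) = ((2 * a + b : ℤ) : ℝ) := by push_cast; ring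
  rw [this, Int.floor_intCast]
  ring

lemma exists_D_eq_zero (d : ℕ) : ∀ (x : ℝ) (N : ℕ), (D N x).natAbs = d →
    ∃ x' M, N ≤ M ∧ ⌊2 ^ N * x'⌋ = ⌊2 ^ N * x⌋ ∧ D M x' = 0 := by
  induction d with
  | zero => exact fun x N h => ⟨x, N, le_rfl, rfl, by omega⟩
  | succ d ih =>
    intro x N h
    obtain ⟨b, hb, hbd⟩ : ∃ b : ℤ, (b = 0 ∨ b = 1) ∧ (D N x + (1 - 2 * b)).natAbs = d := by
      rcases le_total 0 (D N x) with h0 | h0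
      · exact ⟨1, by simp, by omega⟩
      · exact ⟨0, by simp, by omega⟩
    obtain ⟨x₁, hfl₁, hD₁⟩ := exists_D_succ_eq x N hb
    obtain ⟨x₂, M, hM, hfl₂, hD₂⟩ := ih x₁ (N + 1) (by rw [hD₁, hbd])
    exact ⟨x₂, M, by omega, (floor_two_pow_mul_eq_of_le (by omega) hfl₂).trans hfl₁, hD₂⟩

/-- The number of returns to zero of `j ↦ D j x` up to time `M`. -/
noncomputable def zeroCount (M : ℕ) (x : ℝ) : ℕ :=
  ((Finset.Icc 1 M).filter (fun j => D j x = 0)).card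

lemma zeroCount_zero (x : ℝ) : zeroCount 0 x = 0 := by simp [zeroCount]

lemma zeroCount_succ (M : ℕ) (x : ℝ) :
    zeroCount (M + 1) x = zeroCount M x + if D (M + 1) x = 0 then 1 else 0 := by
  unfold zeroCount
  simp only [Finset.card_filter]
  rw [Finset.sum_Icc_succ_top (by omega)]

lemma zeroCount_mono (x : ℝ) : Monotone fun M => zeroCount M x :=
  monotone_nat_of_le_succ fun M => by rw [zeroCount_succ]; omega

lemma zeroCount_eq_of_floor_eq {x y : ℝ} {j N : ℕ} (hj : j ≤ N)
    (h : ⌊2 ^ N * x⌋ = ⌊2 ^ N * y⌋) : zeroCount j x = zeroCount j y := by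
  unfold zeroCount
  congr 1
  refine Finset.filter_congr fun i hi => ?_
  rw [Finset.mem_Icc] at hi
  rw [D_eq_of_floor_eq (by omega : i ≤ N) h]

lemma exists_le_zeroCount (x : ℝ) (N n : ℕ) :
    ∃ x' M, N ≤ M ∧ ⌊2 ^ N * x'⌋ = ⌊2 ^ N * x⌋ ∧ n ≤ zeroCount M x' := by
  induction n with
  | zero => exact ⟨x, N, le_rfl, rfl, Nat.zero_le _⟩
  | succ n ih =>
    obtain ⟨x₁, M₁, hM₁, hfl₁, hc₁⟩ := ih
    obtain ⟨x₂, M₂, hM₂, hfl₂, hD₂⟩ := exists_D_eq_zero _ x₁ (M₁ + 1) rfl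
    obtain ⟨K, rfl⟩ : ∃ K, M₂ = K + 1 := ⟨M₂ - 1, by omega⟩
    refine ⟨x₂, K + 1, by omega, (floor_two_pow_mul_eq_of_le (by omega) hfl₂).trans hfl₁, ?_⟩
    rw [zeroCount_succ, if_pos hD₂]
    have h1 : zeroCount M₁ x₂ ≤ zeroCount K x₂ := zeroCount_mono x₂ (by omega)
    have h2 := zeroCount_eq_of_floor_eq (by omega : M₁ ≤ M₁ + 1) hfl₂
    omega

/-- The prefix of `x` ending at its `n`-th return to zero is a balanced dyadic rational of
generation `n`, whose hump contains the point of the graph of `T` above `x`. -/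
lemma exists_balanced {x : ℝ} (hx : ⌊x⌋ = 0) {n M : ℕ} (hn : 1 ≤ n) (hM : n ≤ zeroCount M x) :
    ∃ x₀ m, (BalancedOfOrder x₀ m ∧ generation x₀ m = n) ∧
      T x ∈ Icc (T x₀) (T x₀ + (2 / 3) * (1 : ℝ) / 4 ^ m) := by
  classical
  have hex : ∃ K, n ≤ zeroCount K x := ⟨M, hM⟩
  obtain ⟨K, hK⟩ : ∃ K, Nat.find hex = K + 1 := by
    refine Nat.exists_eq_succ_of_ne_zero fun h0 => ?_
    have := Nat.find_spec hex
    rw [h0, zeroCount_zero] at this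
    omega
  have h1 := Nat.find_spec hex
  have h2 := Nat.find_min hex (m := K) (by omega)
  have h3 := zeroCount_succ K x
  rw [hK] at h1
  have hD : D (K + 1) x = 0 := by
    by_contra h
    rw [if_neg h] at h3
    omega
  have hc : zeroCount (K + 1) x = n := by
    rw [if_pos hD] at h3
    omega
  obtain ⟨m, hm⟩ : ∃ m, K + 1 = 2 * m := by
    obtain ⟨r, hr⟩ := even_D_sub (K + 1) x
    rw [hD] at hr
    exact ⟨(-r).toNat, by omega⟩
  rw [hm] at hD hc
  have hfl : ⌊2 ^ (2 * m) * (⌊2 ^ (2 * m) * x⌋ / 2 ^ (2 * m) : ℝ)⌋ = ⌊2 ^ (2 * m) * x⌋ := by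
    rw [mul_div_cancel₀ _ (by positivity : (2 : ℝ) ^ (2 * m) ≠ 0), Int.floor_intCast]
  refine ⟨⌊2 ^ (2 * m) * x⌋ / 2 ^ (2 * m), m, ⟨⟨?_, ⟨_, rfl⟩, ?_⟩, ?_⟩, ?_⟩
  · have := floor_two_pow_mul_eq_of_le (Nat.zero_le _) hfl
    rwa [pow_zero, one_mul, one_mul, hx, Int.floor_eq_zero_iff] at this
  · rw [D_eq_of_floor_eq le_rfl hfl, hD]
  · exact (zeroCount_eq_of_floor_eq le_rfl hfl).trans hc
  · have h4 : (4 : ℝ) ^ m = 2 ^ (2 * m) := by rw [pow_mul]; norm_num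
    have h5 := T_nonneg (2 ^ (2 * m) * x)
    have h6 := T_le_two_thirds (2 ^ (2 * m) * x)
    rw [T_eq_of_D_eq_zero hD, h4, mul_one]
    constructor
    · have : 0 ≤ T (2 ^ (2 * m) * x) / 2 ^ (2 * m) := by positivity
      linarith
    · gcongr

theorem stmt9 (n : ℕ) (hn : 1 ≤ n) :
    Set.Icc (0:ℝ) (2/3) ⊆ closure
      (⋃ (x₀ : ℝ) (m : ℕ) (_ : BalancedOfOrder x₀ m ∧ generation x₀ m = n),
        Set.Icc (T x₀) (T x₀ + (2/3) * (1:ℝ) / 4 ^ m)) := by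
  intro y hy
  obtain ⟨x, hx, rfl⟩ := exists_T_eq hy
  have hx0 : ⌊x⌋ = 0 := Int.floor_eq_zero_iff.2 ⟨hx.1, by linarith [hx.2]⟩
  rw [Metric.mem_closure_iff]
  intro ε hε
  obtain ⟨δ, hδ, hcont⟩ := Metric.continuous_iff.1 continuous_T x ε hε
  obtain ⟨N, hN⟩ := exists_pow_lt_of_lt_one hδ (by norm_num : (1 / 2 : ℝ) < 1)
  obtain ⟨x', M, -, hfl, hc⟩ := exists_le_zeroCount x N n
  have hx'0 : ⌊x'⌋ = 0 := by
    have := floor_two_pow_mul_eq_of_le (Nat.zero_le N) hfl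
    rwa [pow_zero, one_mul, one_mul, hx0] at this
  obtain ⟨x₀, m, hbal, hmem⟩ := exists_balanced hx'0 hn hc
  refine ⟨T x', ?_, ?_⟩
  · simp only [Set.mem_iUnion]
    exact ⟨x₀, m, hbal, hmem⟩
  · rw [dist_comm]
    refine hcont x' (lt_trans ?_ hN)
    have hlt := Int.abs_sub_lt_one_of_floor_eq_floor hfl
    rw [← mul_sub, abs_mul, abs_of_pos (by positivity : (0 : ℝ) < 2 ^ N)] at hlt
    rw [Real.dist_eq, one_div_pow, lt_div_iff₀ (by positivity)]
    linarith
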